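/- Suppose m distinct points x_1,…,x_m ∈ ℝ^s and Y = [y_j^k] ∈ ℝ^{t×m} are given, λ > 0, and the loss function Q : ℝ^{t×m} → [0,∞) is lower semi-continuous. Then the regularization problem inf{ Q(I_X(f_μ) − Y) + λ‖f_μ‖_{B_N} : f_μ ∈ B_N } has at least one solution; that is, there exists f̂ ∈ B_N such that Q(I_X(f̂) − Y) + λ‖f̂‖_{B_N} ≤ Q(I_X(f_μ) − Y) + λ‖f_μ‖_{B_N} for all f_μ ∈ B_N. -/

import Mathlib

open MeasureTheory Filter Topology
open scoped ZeroAtInfty BigOperators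

noncomputable section

/-- The parameter space of a depth-`D` deep neural network with layer widths
`m 0, m 1, …, m D` (input dimension `m 0 = s`, output dimension `m D = t`). -/
abbrev Params (m : ℕ → ℕ) (D : ℕ) : Type :=
  (j : Fin D) → ((Fin (m (j.1 + 1)) → Fin (m j.1) → ℝ) × (Fin (m (j.1 + 1)) → ℝ))

/-- The deep neural network `N(x, θ)` of depth `D`, defined recursively by
`N¹(x) = W₁ x + b₁` and `N^{j+1}(x) = W_{j+1} σ(N^j(x)) + b_{j+1}`. -/
def NNet (σ : ℝ → ℝ) (m : ℕ → ℕ) :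
    (D : ℕ) → Params m D → (Fin (m 0) → ℝ) → Fin (m D) → ℝ
  | 0, _, x => x
  | 1, θ, x => fun i => (∑ k, (θ ⟨0, Nat.one_pos⟩).1 i k * x k) + (θ ⟨0, Nat.one_pos⟩).2 i
  | (D + 2), θ, x => fun i =>
      (∑ k, (θ (Fin.last (D + 1))).1 i k *
          σ (NNet σ m (D + 1) (fun j => θ j.castSucc) x k))
        + (θ (Fin.last (D + 1))).2 i

/-- The integral of a function against a finite signed (Radon) measure,
via the Jordan decomposition. -/
def sInt {Θ : Type*} [MeasurableSpace Θ] (μ : SignedMeasure Θ) (f : Θ → ℝ) : ℝ :=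
  (∫ θ, f θ ∂μ.toJordanDecomposition.posPart) - ∫ θ, f θ ∂μ.toJordanDecomposition.negPart

/-- The total variation norm of a signed measure. -/
def tvNorm {Θ : Type*} [MeasurableSpace Θ] (μ : SignedMeasure Θ) : ℝ :=
  (μ.totalVariation Set.univ).toReal

/-- `f_μ^k(x) := ∫_Θ N_k(x,θ) ρ(θ) dμ(θ)`. -/
def fMu (σ : ℝ → ℝ) (m : ℕ → ℕ) (D : ℕ) (ρ : Params m D → ℝ)
    (μ : SignedMeasure (Params m D)) : (Fin (m 0) → ℝ) → Fin (m D) → ℝ :=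
  fun x k => sInt μ fun θ => NNet σ m D θ x k * ρ θ

/-- The set `B_N = {f_μ : μ ∈ M(Θ)}`. -/
def BNset (σ : ℝ → ℝ) (m : ℕ → ℕ) (D : ℕ) (ρ : Params m D → ℝ) :
    Set ((Fin (m 0) → ℝ) → Fin (m D) → ℝ) :=
  {f | ∃ μ : SignedMeasure (Params m D), fMu σ m D ρ μ = f}

/-- The norm `‖f‖_{B_N} = inf {‖ν‖_TV : f_ν = f}`. -/
def BNnorm (σ : ℝ → ℝ) (m : ℕ → ℕ) (D : ℕ) (ρ : Params m D → ℝ)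
    (f : (Fin (m 0) → ℝ) → Fin (m D) → ℝ) : ℝ :=
  sInf (tvNorm '' {ν : SignedMeasure (Params m D) | fMu σ m D ρ ν = f})

/-- `S`: the closed linear span in `C₀(Θ)` of the functions `θ ↦ N_k(x,θ)ρ(θ)`
(given here as the bundled family `Kb`). -/
def Sspan (m : ℕ → ℕ) (D : ℕ)
    (Kb : (Fin (m 0) → ℝ) → Fin (m D) → C₀(Params m D, ℝ)) :
    Submodule ℝ C₀(Params m D, ℝ) :=
  (Submodule.span ℝ
    (Set.range fun p : (Fin (m 0) → ℝ) × Fin (m D) => Kb p.1 p.2)).topologicalClosure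

/-- `V_N := span {K_k(x_j, ·) : j, k}`. -/
def VN (m : ℕ → ℕ) (D : ℕ)
    (Kb : (Fin (m 0) → ℝ) → Fin (m D) → C₀(Params m D, ℝ))
    (M : ℕ) (x : Fin M → (Fin (m 0) → ℝ)) : Submodule ℝ C₀(Params m D, ℝ) :=
  Submodule.span ℝ (Set.range fun p : Fin (m D) × Fin M => Kb (x p.2) p.1)

/-- The interpolation condition `f(x_j) = y_j`, i.e. `f_k(x_j) = y_j^k` for all `j, k`. -/
def interpolates (m : ℕ → ℕ) (D : ℕ) (M : ℕ) (x : Fin M → (Fin (m 0) → ℝ))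
    (Y : Fin (m D) → Fin M → ℝ) (f : (Fin (m 0) → ℝ) → Fin (m D) → ℝ) : Prop :=
  ∀ (j : Fin M) (k : Fin (m D)), f (x j) k = Y k j

/-- The solution set `S_{X,Y}` of the MNI problem
`inf {‖f‖_{B_N} : f ∈ B_N, f(x_j) = y_j}`. -/
def MNISolSet (σ : ℝ → ℝ) (m : ℕ → ℕ) (D : ℕ) (ρ : Params m D → ℝ)
    (M : ℕ) (x : Fin M → (Fin (m 0) → ℝ)) (Y : Fin (m D) → Fin M → ℝ) :
    Set ((Fin (m 0) → ℝ) → Fin (m D) → ℝ) :=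
  {f | f ∈ BNset σ m D ρ ∧ interpolates m D M x Y f ∧
    ∀ μ : SignedMeasure (Params m D), interpolates m D M x Y (fMu σ m D ρ μ) →
      BNnorm σ m D ρ f ≤ BNnorm σ m D ρ (fMu σ m D ρ μ)}

/-- The solution set of the measure MNI problem
`inf {‖μ‖_TV : μ ∈ M(Θ), ∫ K_k(x_j,·) dμ = y_j^k}`. -/
def MeasSolSet (σ : ℝ → ℝ) (m : ℕ → ℕ) (D : ℕ) (ρ : Params m D → ℝ)
    (M : ℕ) (x : Fin M → (Fin (m 0) → ℝ)) (Y : Fin (m D) → Fin M → ℝ) :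
    Set (SignedMeasure (Params m D)) :=
  {μ | interpolates m D M x Y (fMu σ m D ρ μ) ∧
    ∀ ν : SignedMeasure (Params m D), interpolates m D M x Y (fMu σ m D ρ ν) →
      tvNorm μ ≤ tvNorm ν}

/-- The subdifferential `∂‖·‖_∞(g) ⊆ B_N` of the supremum norm at `g ∈ S`, viewing `B_N`
as the dual of `S` via the (representation independent) pairing `⟨f_μ, g⟩ = ∫ g dμ`:
`∂‖·‖_∞(g) = {f_μ ∈ B_N : ‖f_μ‖_{B_N} = 1, ∫ g dμ = ‖g‖_∞}`. -/
def subdiffSup (σ : ℝ → ℝ) (m : ℕ → ℕ) (D : ℕ) (ρ : Params m D → ℝ)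
    (g : C₀(Params m D, ℝ)) : Set ((Fin (m 0) → ℝ) → Fin (m D) → ℝ) :=
  {f | f ∈ BNset σ m D ρ ∧ BNnorm σ m D ρ f = 1 ∧
    ∀ μ : SignedMeasure (Params m D), fMu σ m D ρ μ = f → sInt μ (fun θ => g θ) = ‖g‖}

/-- Feasibility for the dual problem: `‖∑_{k,j} c_{kj} K_k(x_j,·)‖_∞ = 1`. -/
def dualFeasible (m : ℕ → ℕ) (D : ℕ)
    (Kb : (Fin (m 0) → ℝ) → Fin (m D) → C₀(Params m D, ℝ))
    (M : ℕ) (x : Fin M → (Fin (m 0) → ℝ)) (c : Fin (m D) → Fin M → ℝ) : Prop :=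
  ‖∑ k, ∑ j, c k j • Kb (x j) k‖ = 1

/-- The objective `∑_{k,j} c_{kj} y_j^k` of the dual problem. -/
def dualObjective (m : ℕ → ℕ) (D : ℕ) (M : ℕ) (Y : Fin (m D) → Fin M → ℝ)
    (c : Fin (m D) → Fin M → ℝ) : ℝ :=
  ∑ k, ∑ j, c k j * Y k j

/-- `c` is a solution of the dual problem. -/
def dualSolves (m : ℕ → ℕ) (D : ℕ)
    (Kb : (Fin (m 0) → ℝ) → Fin (m D) → C₀(Params m D, ℝ))
    (M : ℕ) (x : Fin M → (Fin (m 0) → ℝ)) (Y : Fin (m D) → Fin M → ℝ)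
    (c : Fin (m D) → Fin M → ℝ) : Prop :=
  dualFeasible m D Kb M x c ∧
    ∀ c' : Fin (m D) → Fin M → ℝ, dualFeasible m D Kb M x c' →
      dualObjective m D M Y c' ≤ dualObjective m D M Y c

/-- `ĝ := C* · ∑_{k,j} ĉ_{kj} K_k(x_j,·)`, where `C*` is the optimal dual value
(the value of the dual objective at the dual solution `c`). -/
def ghat (m : ℕ → ℕ) (D : ℕ)
    (Kb : (Fin (m 0) → ℝ) → Fin (m D) → C₀(Params m D, ℝ))
    (M : ℕ) (x : Fin M → (Fin (m 0) → ℝ)) (Y : Fin (m D) → Fin M → ℝ)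
    (c : Fin (m D) → Fin M → ℝ) : C₀(Params m D, ℝ) :=
  dualObjective m D M Y c • ∑ k, ∑ j, c k j • Kb (x j) k

/-- `Θ(g) := {θ ∈ Θ : |g(θ)| = ‖g‖_∞}`. -/
def ThetaSet (m : ℕ → ℕ) (D : ℕ) (g : C₀(Params m D, ℝ)) : Set (Params m D) :=
  {θ | |g θ| = ‖g‖}

/-- The regularization objective `Q(I_X(f) − Y) + λ ‖f‖_{B_N}`. -/
def regObj (σ : ℝ → ℝ) (m : ℕ → ℕ) (D : ℕ) (ρ : Params m D → ℝ)
    (M : ℕ) (x : Fin M → (Fin (m 0) → ℝ)) (Y : Fin (m D) → Fin M → ℝ)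
    (lam : ℝ) (Q : (Fin (m D) → Fin M → ℝ) → ℝ)
    (f : (Fin (m 0) → ℝ) → Fin (m D) → ℝ) : ℝ :=
  Q ((fun k j => f (x j) k) - Y) + lam * BNnorm σ m D ρ f

/-- The solution set `R_{X,Y}` of the regularization problem. -/
def RegSolSet (σ : ℝ → ℝ) (m : ℕ → ℕ) (D : ℕ) (ρ : Params m D → ℝ)
    (M : ℕ) (x : Fin M → (Fin (m 0) → ℝ)) (Y : Fin (m D) → Fin M → ℝ)
    (lam : ℝ) (Q : (Fin (m D) → Fin M → ℝ) → ℝ) :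
    Set ((Fin (m 0) → ℝ) → Fin (m D) → ℝ) :=
  {f | f ∈ BNset σ m D ρ ∧
    ∀ μ : SignedMeasure (Params m D),
      regObj σ m D ρ M x Y lam Q f ≤ regObj σ m D ρ M x Y lam Q (fMu σ m D ρ μ)}

/-- `D_{X,Y} := I_X(R_{X,Y})`. -/
def DXY (σ : ℝ → ℝ) (m : ℕ → ℕ) (D : ℕ) (ρ : Params m D → ℝ)
    (M : ℕ) (x : Fin M → (Fin (m 0) → ℝ)) (Y : Fin (m D) → Fin M → ℝ)
    (lam : ℝ) (Q : (Fin (m D) → Fin M → ℝ) → ℝ) : Set (Fin (m D) → Fin M → ℝ) :=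
  (fun f => fun k j => f (x j) k) '' RegSolSet σ m D ρ M x Y lam Q



/-- In a finite-dimensional real vector space the convex hull of a compact set is compact. -/
theorem IsCompact.convexHull_of_finiteDimensional {E : Type*} [NormedAddCommGroup E]
    [NormedSpace ℝ E] [FiniteDimensional ℝ E] {s : Set E} (hs : IsCompact s) :
    IsCompact (convexHull ℝ s) := by
  have key : convexHull ℝ s = ⋃ n ∈ Finset.range (Module.finrank ℝ E + 2),
      (fun q : (Fin n → ℝ) × (Fin n → E) => ∑ i, q.1 i • q.2 i) ''
        (stdSimplex ℝ (Fin n) ×ˢ Set.univ.pi fun _ => s) := by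
    apply Set.Subset.antisymm
    · intro y hy
      obtain ⟨ι, _, z, w, hz, hai, hw, hw1, hwz⟩ := eq_pos_convex_span_of_mem_convexHull hy
      have hcard : Fintype.card ι ≤ Module.finrank ℝ E + 1 := hai.card_le_finrank_succ.trans
        (Nat.add_le_add_right (Submodule.finrank_le _) 1)
      let e := (Fintype.equivFin ι).symm
      simp only [Set.mem_iUnion]
      refine ⟨Fintype.card ι, Finset.mem_range.2 (by omega), (w ∘ e, z ∘ e),
        ⟨⟨fun i => (hw _).le, ?_⟩,
        fun i _ => hz ⟨_, rfl⟩⟩, ?_⟩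
      · rw [← hw1]
        exact e.sum_comp w
      · rw [← hwz]
        exact e.sum_comp fun i => w i • z i
    · simp only [Set.iUnion_subset_iff]
      rintro n - _ ⟨⟨w, z⟩, ⟨hw, hz⟩, rfl⟩
      exact (convex_convexHull ℝ s).sum_mem (fun i _ => hw.1 i) hw.2
        fun i _ => subset_convexHull ℝ s (hz i trivial)
  rw [key]
  refine (Finset.range _).isCompact_biUnion fun n _ => ?_
  exact ((isCompact_stdSimplex ℝ (Fin n)).prod (isCompact_univ_pi fun _ => hs)).image
    (by fun_prop)

section MeasureRepresentation

variable {Θ : Type*} [MeasurableSpace Θ]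

/-- The integral against a difference of finite measures is the difference of the integrals. -/
theorem sInt_toSignedMeasure_sub (p n : Measure Θ) [IsFiniteMeasure p] [IsFiniteMeasure n]
    {f : Θ → ℝ} (hp : Integrable f p) (hn : Integrable f n) :
    sInt (p.toSignedMeasure - n.toSignedMeasure) f = (∫ θ, f θ ∂p) - ∫ θ, f θ ∂n := by
  set μ := p.toSignedMeasure - n.toSignedMeasure with hμ
  have hpos : μ.toJordanDecomposition.posPart = p - n := by
    rw [hμ, Measure.toJordanDecomposition_toSignedMeasure_sub]
    rfl
  have hneg : μ.toJordanDecomposition.negPart = n - p := by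
    rw [hμ, Measure.toJordanDecomposition_toSignedMeasure_sub]
    rfl
  have hsum : μ.toJordanDecomposition.posPart + n = p + μ.toJordanDecomposition.negPart := by
    have h := μ.toSignedMeasure_toJordanDecomposition
    rw [JordanDecomposition.toSignedMeasure, hμ, sub_eq_sub_iff_add_eq_add,
      ← Measure.toSignedMeasure_add, ← Measure.toSignedMeasure_add, Measure.toSignedMeasure_eq_toSignedMeasure_iff] at h
    exact h
  have hip : Integrable f μ.toJordanDecomposition.posPart :=
    hp.mono_measure (hpos ▸ Measure.sub_le)
  have hin : Integrable f μ.toJordanDecomposition.negPart :=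
    hn.mono_measure (hneg ▸ Measure.sub_le)
  have hint := congrArg (fun ν : Measure Θ => ∫ θ, f θ ∂ν) hsum
  simp only [integral_add_measure hip hn, integral_add_measure hp hin] at hint
  rw [sInt]
  linarith

theorem tvNorm_eq_add (μ : SignedMeasure Θ) :
    tvNorm μ = μ.toJordanDecomposition.posPart.real Set.univ +
      μ.toJordanDecomposition.negPart.real Set.univ := by
  rw [tvNorm, SignedMeasure.totalVariation, Measure.add_apply,
    ENNReal.toReal_add (measure_ne_top _ _) (measure_ne_top _ _)]
  rfl

theorem tvNorm_nonneg (μ : SignedMeasure Θ) : 0 ≤ tvNorm μ := ENNReal.toReal_nonneg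

theorem tvNorm_toSignedMeasure_sub_le (p n : Measure Θ) [IsFiniteMeasure p] [IsFiniteMeasure n] :
    tvNorm (p.toSignedMeasure - n.toSignedMeasure) ≤ p.real Set.univ + n.real Set.univ := by
  rw [tvNorm_eq_add, Measure.toJordanDecomposition_toSignedMeasure_sub]
  exact add_le_add (ENNReal.toReal_mono (measure_ne_top _ _) (Measure.sub_le _))
    (ENNReal.toReal_mono (measure_ne_top _ _) (Measure.sub_le _))

variable {E : Type*} [NormedAddCommGroup E] [NormedSpace ℝ E]

/-- Every point of the convex hull of `0` and the range of `φ` is the integral of `φ` against a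
positive measure of mass at most one. -/
theorem exists_measure_integral_eq_of_mem_convexHull [MeasurableSingletonClass Θ]
    [CompleteSpace E] {φ : Θ → E}
    (hφ : ∀ (p : Measure Θ) [IsFiniteMeasure p], Integrable φ p) {c : E}
    (hc : c ∈ convexHull ℝ (insert 0 (Set.range φ))) :
    ∃ p : Measure Θ, IsFiniteMeasure p ∧ p.real Set.univ ≤ 1 ∧ ∫ θ, φ θ ∂p = c := by
  refine convexHull_min (s := insert 0 (Set.range φ))
    (t := {c | ∃ p : Measure Θ, IsFiniteMeasure p ∧ p.real Set.univ ≤ 1 ∧ ∫ θ, φ θ ∂p = c})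
    ?_ ?_ hc
  · rintro _ (rfl | ⟨θ, rfl⟩)
    · exact ⟨0, inferInstance, by simp, by simp⟩
    · exact ⟨Measure.dirac θ, inferInstance, by simp, by simp⟩
  · rintro _ ⟨p, hp, hp1, rfl⟩ _ ⟨q, hq, hq1, rfl⟩ a b ha hb hab
    lift a to NNReal using ha
    lift b to NNReal using hb
    refine ⟨a • p + b • q, inferInstance, ?_, ?_⟩
    · rw [measureReal_add_apply, measureReal_nnreal_smul_apply, measureReal_nnreal_smul_apply]
      nlinarith [a.2, b.2]
    · rw [integral_add_measure (hφ _) (hφ _), integral_smul_nnreal_measure,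
        integral_smul_nnreal_measure]
      rfl

/-- The integral of `φ` against a finite measure is the mass of the measure times a point of the
convex hull of `0` and the range of `φ`, provided that this hull is closed. -/
theorem exists_mem_convexHull_integral_eq [CompleteSpace E] {φ : Θ → E}
    (hK : IsClosed (convexHull ℝ (insert 0 (Set.range φ)))) (p : Measure Θ) [IsFiniteMeasure p]
    (hφ : Integrable φ p) :
    ∃ c ∈ convexHull ℝ (insert 0 (Set.range φ)), ∫ θ, φ θ ∂p = p.real Set.univ • c := by
  rcases eq_zero_or_neZero p with rfl | _
  · exact ⟨0, subset_convexHull ℝ _ (Set.mem_insert _ _), by simp⟩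
  · refine ⟨⨍ θ, φ θ ∂p, (convex_convexHull ℝ _).average_mem hK (.of_forall fun θ =>
      subset_convexHull ℝ _ (Set.mem_insert_of_mem _ ⟨θ, rfl⟩)) hφ, ?_⟩
    rw [measure_smul_average]

end MeasureRepresentation

/-- A lower semicontinuous data term of finitely many `C₀` measurements plus a positive multiple
of the total variation norm has a minimizer among signed measures. -/
theorem exists_minimizer_add_tvNorm {Θ ι : Type*} [TopologicalSpace Θ] [MeasurableSpace Θ]
    [BorelSpace Θ] [MeasurableSingletonClass Θ] [Fintype ι] (K : ι → C₀(Θ, ℝ)) {lam : ℝ}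
    (hlam : 0 < lam) {F : (ι → ℝ) → ℝ} (hF0 : ∀ z, 0 ≤ F z) (hF : LowerSemicontinuous F) :
    ∃ μ : SignedMeasure Θ, ∀ ν : SignedMeasure Θ,
      F (fun i => sInt μ (K i)) + lam * tvNorm μ ≤ F (fun i => sInt ν (K i)) + lam * tvNorm ν := by
  let φ : Θ → ι → ℝ := fun θ i => K i θ
  have hK (i : ι) (p : Measure Θ) [IsFiniteMeasure p] : Integrable (K i) p :=
    .of_bound (K i).continuous.measurable.aestronglyMeasurable ‖K i‖
      (.of_forall fun θ => (K i).toBCF.norm_coe_le_norm θ)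
  have hφ (p : Measure Θ) [IsFiniteMeasure p] : Integrable φ p := .of_eval fun i => hK i p
  have hφi (p : Measure Θ) [IsFiniteMeasure p] (i : ι) : (∫ θ, φ θ ∂p) i = ∫ θ, K i θ ∂p :=
    eval_integral (fun i => hK i p) i
  have hcomp : IsCompact (convexHull ℝ (insert 0 (Set.range φ))) := by
    refine IsCompact.convexHull_of_finiteDimensional
      (Tendsto.isCompact_insert_range_of_cocompact ?_ ?_)
    · exact tendsto_pi_nhds.2 fun i => (K i).zero_at_infty'
    · exact continuous_pi fun i => (K i).continuous
  set C := convexHull ℝ (insert 0 (Set.range φ))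
  have h0C : (0 : ι → ℝ) ∈ C := subset_convexHull ℝ _ (Set.mem_insert _ _)
  let H : (ℝ × ℝ) × (ι → ℝ) × (ι → ℝ) → ℝ :=
    fun q => F (q.1.1 • q.2.1 - q.1.2 • q.2.2) + lam * (q.1.1 + q.1.2)
  have hH : LowerSemicontinuous H :=
    (hF.comp (g := fun q : (ℝ × ℝ) × (ι → ℝ) × (ι → ℝ) =>
      q.1.1 • q.2.1 - q.1.2 • q.2.2) (by fun_prop)).add
      (Continuous.lowerSemicontinuous (by fun_prop))
  set R := F 0 / lam with hR
  have hR0 : 0 ≤ R := div_nonneg (hF0 _) hlam.le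
  let S : Set ((ℝ × ℝ) × (ι → ℝ) × (ι → ℝ)) :=
    (Set.Icc 0 R ×ˢ Set.Icc 0 R) ×ˢ (C ×ˢ C)
  have h0S : ((0, 0), (0, 0)) ∈ S := ⟨⟨⟨le_rfl, hR0⟩, ⟨le_rfl, hR0⟩⟩, h0C, h0C⟩
  obtain ⟨⟨⟨r₁, r₂⟩, c₁, c₂⟩, ⟨⟨⟨hr₁, -⟩, ⟨hr₂, -⟩⟩, hc₁, hc₂⟩, hmin⟩ :=
    (hH.lowerSemicontinuousOn S).exists_isMinOn ⟨_, h0S⟩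
      ((isCompact_Icc.prod isCompact_Icc).prod (hcomp.prod hcomp))
  obtain ⟨p, _, hp1, hpc⟩ := exists_measure_integral_eq_of_mem_convexHull hφ hc₁
  obtain ⟨n, _, hn1, hnc⟩ := exists_measure_integral_eq_of_mem_convexHull hφ hc₂
  dsimp only at hr₁ hr₂
  lift r₁ to NNReal using hr₁
  lift r₂ to NNReal using hr₂
  refine ⟨(r₁ • p).toSignedMeasure - (r₂ • n).toSignedMeasure, fun ν => ?_⟩
  have hleft : F (fun i => sInt ((r₁ • p).toSignedMeasure - (r₂ • n).toSignedMeasure) (K i)) +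
      lam * tvNorm ((r₁ • p).toSignedMeasure - (r₂ • n).toSignedMeasure) ≤
      H ((r₁, r₂), (c₁, c₂)) := by
    refine add_le_add (le_of_eq (congrArg F ?_)) (mul_le_mul_of_nonneg_left ?_ hlam.le)
    · funext i
      rw [sInt_toSignedMeasure_sub _ _ (hK i _) (hK i _), integral_smul_nnreal_measure,
        integral_smul_nnreal_measure, ← hφi, ← hφi, hpc, hnc]
      rfl
    · refine (tvNorm_toSignedMeasure_sub_le _ _).trans ?_
      rw [measureReal_nnreal_smul_apply, measureReal_nnreal_smul_apply]
      exact add_le_add (mul_le_of_le_one_right r₁.2 hp1) (mul_le_of_le_one_right r₂.2 hn1)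
  refine hleft.trans ?_
  rcases le_total (tvNorm ν) R with hν | hν
  · obtain ⟨d₁, hd₁, hd₁'⟩ := exists_mem_convexHull_integral_eq hcomp.isClosed
      ν.toJordanDecomposition.posPart (hφ _)
    obtain ⟨d₂, hd₂, hd₂'⟩ := exists_mem_convexHull_integral_eq hcomp.isClosed
      ν.toJordanDecomposition.negPart (hφ _)
    rw [tvNorm_eq_add] at hν ⊢
    have h1 : 0 ≤ ν.toJordanDecomposition.posPart.real Set.univ := measureReal_nonneg
    have h2 : 0 ≤ ν.toJordanDecomposition.negPart.real Set.univ := measureReal_nonneg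
    refine (hmin (show ((ν.toJordanDecomposition.posPart.real Set.univ,
      ν.toJordanDecomposition.negPart.real Set.univ), (d₁, d₂)) ∈ S from
      ⟨⟨⟨h1, by linarith⟩, ⟨h2, by linarith⟩⟩, hd₁, hd₂⟩)).trans_eq ?_
    dsimp only [H]
    rw [← hd₁', ← hd₂']
    congr 2
    funext i
    rw [Pi.sub_apply, hφi, hφi]
    rfl
  · refine (hmin h0S).trans ?_
    have : F 0 = lam * R := by rw [hR]; field_simp
    have h3 := mul_le_mul_of_nonneg_left hν hlam.le
    have h4 := hF0 fun i => sInt ν (K i)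
    simp only [H, smul_zero, sub_zero, add_zero, mul_zero]
    linarith

theorem BNnorm_le_tvNorm (σ : ℝ → ℝ) (m : ℕ → ℕ) (D : ℕ) (ρ : Params m D → ℝ)
    (μ : SignedMeasure (Params m D)) : BNnorm σ m D ρ (fMu σ m D ρ μ) ≤ tvNorm μ :=
  csInf_le ⟨0, by rintro _ ⟨ν, -, rfl⟩; exact tvNorm_nonneg ν⟩ ⟨μ, rfl, rfl⟩

/-- For `λ > 0` and a lower semi-continuous loss
`Q : ℝ^{t×m} → [0,∞)`, the regularization problem
`inf {Q(I_X(f_μ) − Y) + λ‖f_μ‖_{B_N} : f_μ ∈ B_N}` has at least one solution. -/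
theorem statement_11
    (σ : ℝ → ℝ) (hσ : Continuous σ) (m : ℕ → ℕ) (D : ℕ) (hD : 0 < D)
    (ρ : Params m D → ℝ) (hρc : Continuous ρ) (hρpos : ∀ θ, 0 < ρ θ)
    (Kb : (Fin (m 0) → ℝ) → Fin (m D) → C₀(Params m D, ℝ))
    (hKb : ∀ x k θ, Kb x k θ = NNet σ m D θ x k * ρ θ)
    (M : ℕ) (x : Fin M → (Fin (m 0) → ℝ)) (hx : Function.Injective x)
    (Y : Fin (m D) → Fin M → ℝ) (lam : ℝ) (hlam : 0 < lam)
    (Q : (Fin (m D) → Fin M → ℝ) → ℝ) (hQ0 : ∀ z, 0 ≤ Q z)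
    (hQl : LowerSemicontinuous Q) :
    (RegSolSet σ m D ρ M x Y lam Q).Nonempty := by
  have hF : LowerSemicontinuous fun z : Fin (m D) × Fin M → ℝ => Q ((fun k j => z (k, j)) - Y) :=
    hQl.comp (g := fun z : Fin (m D) × Fin M → ℝ => (fun k j => z (k, j)) - Y)
      (by fun_prop)
  obtain ⟨μ, hμ⟩ := exists_minimizer_add_tvNorm
    (fun q : Fin (m D) × Fin M => Kb (x q.2) q.1) hlam (fun z => hQ0 _) hF
  have hdata (ν : SignedMeasure (Params m D)) (k : Fin (m D)) (j : Fin M) :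
      sInt ν (Kb (x j) k) = fMu σ m D ρ ν (x j) k :=
    congrArg (sInt ν) (funext (hKb (x j) k))
  simp only [hdata] at hμ
  refine ⟨fMu σ m D ρ μ, ⟨μ, rfl⟩, fun ν => ?_⟩
  have hle : (regObj σ m D ρ M x Y lam Q (fMu σ m D ρ μ) -
      Q ((fun k j => fMu σ m D ρ ν (x j) k) - Y)) / lam ≤ BNnorm σ m D ρ (fMu σ m D ρ ν) := by
    refine le_csInf ⟨_, ν, rfl, rfl⟩ ?_
    rintro _ ⟨ν', hν', rfl⟩
    rw [div_le_iff₀' hlam, sub_le_iff_le_add', regObj]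
    have h := hμ ν'
    rw [show fMu σ m D ρ ν' = fMu σ m D ρ ν from hν'] at h
    exact (add_le_add_right
      (mul_le_mul_of_nonneg_left (BNnorm_le_tvNorm σ m D ρ μ) hlam.le) _).trans h
  rw [div_le_iff₀' hlam, sub_le_iff_le_add'] at hle
  exact hle

end
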